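/- arXiv:1407.2583 — 2 statements merged into one kernel-verified Lean document; each statement's English description precedes it below -/
import Mathlib

section
/- Let M be a finitely generated module over R = ℤ[x₁,…,xₙ]. Then for all but finitely many prime integers p, every associated prime of M̄ = M/pM is a minimal prime over an ideal of the form pR + 𝔭, where 𝔭 is an associated prime of M. -/
noncomputable section

/-- `R = ℤ[x₁,…,xₙ]`. -/
abbrev Rint (n : ℕ) : Type := MvPolynomial (Fin n) ℤ

/-- `pM`, the submodule of multiples of `p`. -/
abbrev pSM (n : ℕ) (p : ℕ) (M : Type*) [AddCommGroup M] [Module (Rint n) M] :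
    Submodule (Rint n) M :=
  Ideal.span {(p : Rint n)} • (⊤ : Submodule (Rint n) M)

open Submodule in
theorem finite_torsion_primes (C : Type*) [CommRing C] [IsNoetherianRing C] (Q : Type*)
    [AddCommGroup Q] [Module C Q] [Module.Finite C Q] :
    {p : ℕ | p.Prime ∧ ∃ x : Q, x ≠ 0 ∧ (p : C) • x = 0}.Finite := by
  have hfin := associatedPrimes.finite C Q
  refine (hfin.biUnion (t := fun P => {p : ℕ | p.Prime ∧ (p : C) ∈ P}) ?_).subset ?_
  · intro P hP
    have : P.IsPrime := IsAssociatedPrime.isPrime hP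
    apply Set.Subsingleton.finite
    intro a ha b hb
    by_contra hab
    have hc : IsCoprime (a : ℤ) (b : ℤ) :=
      Nat.isCoprime_iff_coprime.mpr ((Nat.coprime_primes ha.1 hb.1).mpr hab)
    obtain ⟨u, v, huv⟩ := hc
    apply this.ne_top
    rw [Ideal.eq_top_iff_one]
    have h1 : ((u : C) * (a : C) + v * b) = 1 := by exact_mod_cast congrArg (Int.cast : ℤ → C) huv
    rw [← h1]
    exact add_mem (P.mul_mem_left _ ha.2) (P.mul_mem_left _ hb.2)
  · rintro p ⟨hp, x, hx⟩
    have : (p : C) ∈ ⋃ p ∈ associatedPrimes C Q, (p : Set C) := by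
      rw [biUnion_associatedPrimes_eq_zero_divisors]
      exact ⟨x, hx⟩
    simp only [Set.mem_iUnion] at this ⊢
    obtain ⟨P, hP, h⟩ := this
    exact ⟨P, hP, hp, h⟩

theorem finite_bad_primes_torsionfree (C : Type*) [CommRing C] [IsDomain C] [IsNoetherianRing C]
    (M : Type*) [AddCommGroup M] [Module C M] [Module.Finite C M]
    (htf : ∀ (c : C) (x : M), c ≠ 0 → c • x = 0 → x = 0)
    (hpr : ∀ p : ℕ, p.Prime → Prime (p : C)) :
    {p : ℕ | p.Prime ∧ ∃ (e : C) (a b : M), ¬ (p : C) ∣ e ∧ e • a = (p : C) • b ∧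
      ¬ ∃ a', a = (p : C) • a'}.Finite := by
  classical
  obtain ⟨k, v, hv⟩ := Module.Finite.exists_fin (R := C) (M := M)
  obtain ⟨s, hs, hs'⟩ := exists_maximal_linearIndepOn C v
  have hex : ∀ i, ∃ a : C, a ≠ 0 ∧ a • v i ∈ Submodule.span C (v '' s) := by
    intro i
    by_cases hi : i ∈ s
    · exact ⟨1, one_ne_zero, by
        rw [one_smul]; exact Submodule.subset_span (Set.mem_image_of_mem _ hi)⟩
    · exact hs' i hi
  choose c hc0 hc using hex
  set d := ∏ i, c i with hd
  have hd0 : d ≠ 0 := Finset.prod_ne_zero_iff.mpr fun i _ => hc0 i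
  have hdF : ∀ m : M, d • m ∈ Submodule.span C (v '' s) := by
    intro m
    have hm : m ∈ Submodule.span C (Set.range v) := hv ▸ Submodule.mem_top
    induction hm using Submodule.span_induction with
    | mem x hx =>
      obtain ⟨i, rfl⟩ := hx
      obtain ⟨w, hw⟩ := Finset.dvd_prod_of_mem c (Finset.mem_univ i)
      rw [hd, hw, mul_comm, mul_smul]
      exact Submodule.smul_mem _ _ (hc i)
    | zero => simp
    | add x y _ _ hx hy => rw [smul_add]; exact add_mem hx hy
    | smul a x _ hx => rw [smul_comm]; exact Submodule.smul_mem _ _ hx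
  let D : Submodule C M := LinearMap.range (LinearMap.lsmul C M d)
  refine (finite_torsion_primes C (M ⧸ D)).subset ?_
  rintro p ⟨hp, e, a, b, hpe, hab, hna⟩
  refine ⟨hp, ?_⟩
  have hw : ∃ w : M, d • a = (p : C) • w := by
    have hli : LinearIndependent C (fun x : s => v x) := hs
    have hspan : v '' s = Set.range (fun x : s => v x) := by
      ext; simp
    have ha := hdF a
    have hb := hdF b
    rw [hspan] at ha hb
    let fa := hli.repr ⟨_, ha⟩
    let fb := hli.repr ⟨_, hb⟩
    have hfa : Finsupp.linearCombination C (fun x : s => v x) fa = d • a :=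
      hli.linearCombination_repr ⟨_, ha⟩
    have hfab : e • fa = (p : C) • fb := by
      rw [← map_smul, ← map_smul]
      congr 1
      ext
      simp only [Submodule.coe_smul]
      rw [smul_comm, hab, smul_comm]
    have hdiv : ∀ i, (p : C) ∣ fa i := by
      intro i
      have h1 : e * fa i = p * fb i := by simpa using DFunLike.congr_fun hfab i
      exact ((hpr p hp).dvd_or_dvd ⟨_, h1⟩).resolve_left hpe
    choose g hg using hdiv
    refine ⟨∑ i ∈ fa.support, g i • v i, ?_⟩
    rw [← hfa, Finsupp.linearCombination_apply, Finsupp.sum, Finset.smul_sum]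
    refine Finset.sum_congr rfl fun i _ => ?_
    conv_lhs => rw [hg i, mul_smul]
  obtain ⟨w, hw⟩ := hw
  refine ⟨D.mkQ w, ?_, ?_⟩
  · intro h0
    rw [Submodule.mkQ_apply, Submodule.Quotient.mk_eq_zero] at h0
    obtain ⟨a', ha'⟩ := h0
    apply hna
    refine ⟨a', ?_⟩
    rw [← sub_eq_zero]
    apply htf d _ hd0
    simp only [LinearMap.lsmul_apply] at ha'
    rw [smul_sub, hw, ← ha', smul_comm, sub_self]
  · rw [← map_smul, ← hw, Submodule.mkQ_apply, Submodule.Quotient.mk_eq_zero]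
    exact ⟨a, rfl⟩

open MvPolynomial in
theorem clear_denominators (s : ℕ) (K : Type*) [CommRing K] (G : MvPolynomial (Fin s) ℚ →+* K)
    (x : K) (hx : G.IsIntegralElem x) :
    ∃ k : ℤ, k ≠ 0 ∧ (G.comp (MvPolynomial.map (algebraMap ℤ ℚ))).IsIntegralElem ((k : K) * x) := by
  let : Algebra (MvPolynomial (Fin s) ℚ) K := G.toAlgebra
  let : Algebra (MvPolynomial (Fin s) ℤ) K :=
    (G.comp (MvPolynomial.map (algebraMap ℤ ℚ))).toAlgebra
  let : Algebra (MvPolynomial (Fin s) ℤ) (MvPolynomial (Fin s) ℚ) := algebraMvPolynomial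
  have : IsScalarTower (MvPolynomial (Fin s) ℤ) (MvPolynomial (Fin s) ℚ) K :=
    IsScalarTower.of_algebraMap_eq' rfl
  obtain ⟨⟨m, hm⟩, hm'⟩ := IsIntegral.exists_multiple_integral_of_isLocalization
    (Rₘ := MvPolynomial (Fin s) ℚ) ((nonZeroDivisors ℤ).map (C (σ := Fin s))) x hx
  obtain ⟨k, hk, rfl⟩ := hm
  refine ⟨k, nonZeroDivisors.ne_zero hk, ?_⟩
  have h3 : (C k : MvPolynomial (Fin s) ℤ) • x = (k : K) * x := by
    rw [Algebra.smul_def]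
    change G (MvPolynomial.map _ (C k)) * _ = _
    simp
  have h4 : IsIntegral (MvPolynomial (Fin s) ℤ) ((C k : MvPolynomial (Fin s) ℤ) • x) := hm'
  rw [h3] at h4
  exact h4

open MvPolynomial in
theorem noether_over_int (n : ℕ) (P I : Ideal (MvPolynomial (Fin n) ℤ)) [P.IsPrime]
    (hPI : P ≤ I.radical) (hP : ∀ k : ℤ, k ≠ 0 → (k : MvPolynomial (Fin n) ℤ) ∉ P) :
    ∃ (s : ℕ) (h : MvPolynomial (Fin s) ℤ →+* MvPolynomial (Fin n) ℤ) (N : ℤ), N ≠ 0 ∧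
      (∀ c, h c ∈ P → c = 0) ∧
      ∀ j, ∃ f : Polynomial (MvPolynomial (Fin s) ℤ), f.Monic ∧
        f.eval₂ h ((N : MvPolynomial (Fin n) ℤ) * X j) ∈ I := by
  classical
  let R := MvPolynomial (Fin n) ℤ
  let K := FractionRing (R ⧸ P)
  let φ : R →+* K := (algebraMap (R ⧸ P) K).comp (Ideal.Quotient.mk P)
  have hφ : ∀ r, φ r = 0 ↔ r ∈ P := by
    intro r
    simp only [φ, RingHom.comp_apply]
    rw [map_eq_zero_iff _ (IsFractionRing.injective (R ⧸ P) K), Ideal.Quotient.eq_zero_iff_mem]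
  have : CharZero K := by
    refine charZero_of_inj_zero fun k hk => ?_
    by_contra hk0
    refine hP k (by exact_mod_cast hk0) ((hφ _).mp ?_)
    simpa using hk
  let ψ : MvPolynomial (Fin n) ℚ →ₐ[ℚ] K := aeval (fun j => φ (X j))
  have hden : ∀ z ∈ ψ.range, ∃ d : ℤ, d ≠ 0 ∧ ∃ r, (d : K) * z = φ r := by
    suffices H : ∀ z, ∃ d : ℤ, d ≠ 0 ∧ ∃ r, (d : K) * ψ z = φ r by
      rintro _ ⟨z, rfl⟩
      exact H z
    intro z
    induction z using MvPolynomial.induction_on with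
    | C a =>
      refine ⟨a.den, by simp, a.num, ?_⟩
      have hne : (a.den : K) ≠ 0 := by exact_mod_cast a.den_nz
      have h1 : ψ (C a) = (a.num : K) / (a.den : K) := by
        rw [← Rat.cast_def]; simp [ψ]
      rw [h1, map_intCast, Int.cast_natCast, mul_div_cancel₀ _ hne]
    | add p q hp hq =>
      obtain ⟨d, hd, r, hr⟩ := hp
      obtain ⟨d', hd', r', hr'⟩ := hq
      refine ⟨d * d', mul_ne_zero hd hd', d' * r + d * r', ?_⟩
      simp only [map_add, map_mul, ← hr, ← hr', map_intCast]
      rw [Int.cast_mul]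
      ring
    | mul_X p i hp =>
      obtain ⟨d, hd, r, hr⟩ := hp
      refine ⟨d, hd, r * X i, ?_⟩
      simp only [map_mul, ← hr]
      simp [ψ]
      ring
  have : Algebra.FiniteType ℚ ψ.range :=
    Algebra.FiniteType.of_surjective ψ.rangeRestrict ψ.rangeRestrict_surjective
  obtain ⟨s, g, hginj, hgint⟩ := exists_integral_inj_algHom_of_fg ℚ ψ.range
  let G : MvPolynomial (Fin s) ℚ →ₐ[ℚ] K := ψ.range.val.comp g
  have hGinj : Function.Injective G := Subtype.val_injective.comp hginj
  have hy : ∀ i, ∃ d : ℤ, d ≠ 0 ∧ ∃ r, (d : K) * G (X i) = φ r := fun i => hden _ (g (X i)).2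
  choose d hd y hdy using hy
  let σ : MvPolynomial (Fin s) ℚ ≃ₐ[ℚ] MvPolynomial (Fin s) ℚ :=
    AlgEquiv.ofAlgHom (aeval fun i => C (d i : ℚ) * X i) (aeval fun i => C ((d i : ℚ)⁻¹) * X i)
      (by
        ext1 i
        have : (d i : ℚ) ≠ 0 := by exact_mod_cast hd i
        simp only [AlgHom.comp_apply, aeval_X, map_mul, AlgHom.id_apply, algHom_C, algebraMap_eq]
        rw [← mul_assoc, ← C_mul, inv_mul_cancel₀ this]; simp)
      (by
        ext1 i
        have : (d i : ℚ) ≠ 0 := by exact_mod_cast hd i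
        simp only [AlgHom.comp_apply, aeval_X, map_mul, AlgHom.id_apply, algHom_C, algebraMap_eq]
        rw [← mul_assoc, ← C_mul, mul_inv_cancel₀ this]; simp)
  let G' : MvPolynomial (Fin s) ℚ →ₐ[ℚ] K := G.comp σ.toAlgHom
  let h : MvPolynomial (Fin s) ℤ →+* R := (aeval y : MvPolynomial (Fin s) ℤ →ₐ[ℤ] R).toRingHom
  have hcomp : φ.comp h = G'.toRingHom.comp (MvPolynomial.map (algebraMap ℤ ℚ)) := by
    apply MvPolynomial.ringHom_ext
    · intro r; simp
    · intro i
      simp [h, G', σ, ← hdy]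
  have hinj : ∀ c, h c ∈ P → c = 0 := by
    intro c hc
    rw [← hφ] at hc
    have h1 : G' (MvPolynomial.map (algebraMap ℤ ℚ) c) = 0 := by
      rw [← hc]; exact (RingHom.congr_fun hcomp c).symm
    have hG' : Function.Injective G' := hGinj.comp σ.injective
    rw [map_eq_zero_iff _ hG'] at h1
    rwa [map_eq_zero_iff _ (MvPolynomial.map_injective _ (algebraMap ℤ ℚ).injective_int)] at h1
  have hint : ∀ j, ∃ k : ℤ, k ≠ 0 ∧ (φ.comp h).IsIntegralElem (φ ((k : R) * X j)) := by
    intro j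
    have h1 : G'.toRingHom.IsIntegralElem (φ (X j)) := by
      obtain ⟨f, hf, hf0⟩ := hgint ⟨φ (X j), ⟨X j, by simp [ψ]⟩⟩
      refine ⟨f.map (σ.symm : MvPolynomial (Fin s) ℚ →+* MvPolynomial (Fin s) ℚ), hf.map _, ?_⟩
      rw [Polynomial.eval₂_map]
      have h2 := congrArg (ψ.range.val : ψ.range →+* K) hf0
      rw [Polynomial.hom_eval₂, map_zero] at h2
      rw [← h2]
      congr 1
      refine RingHom.ext fun x => ?_
      change G (σ (σ.symm _)) = G _
      rw [AlgEquiv.apply_symm_apply]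
    obtain ⟨k, hk, hk'⟩ := clear_denominators s K G'.toRingHom _ h1
    refine ⟨k, hk, ?_⟩
    rw [hcomp, map_mul, map_intCast]
    exact hk'
  choose k hk hkint using hint
  refine ⟨s, h, ∏ j, k j, Finset.prod_ne_zero_iff.mpr fun j _ => hk j, hinj, fun j => ?_⟩
  have h5 : (φ.comp h).IsIntegralElem (φ (((∏ j, k j : ℤ) : R) * X j)) := by
    obtain ⟨w, hw⟩ := Finset.dvd_prod_of_mem k (Finset.mem_univ j)
    rw [hw]
    have : φ (((k j * w : ℤ) : R) * X j) = (φ.comp h) (w : MvPolynomial (Fin s) ℤ) * φ ((k j : R) * X j) := by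
      simp; ring
    rw [this]
    exact RingHom.IsIntegralElem.mul _ (RingHom.isIntegralElem_map _) (hkint j)
  obtain ⟨f, hf, hf0⟩ := h5
  rw [← Polynomial.hom_eval₂, hφ] at hf0
  obtain ⟨l, hl⟩ := hPI hf0
  exact ⟨f ^ l, hf.pow l, by rwa [Polynomial.eval₂_pow]⟩

theorem mem_pSM {n p : ℕ} {M : Type*} [AddCommGroup M] [Module (Rint n) M] {x : M} :
    x ∈ pSM n p M ↔ ∃ y : M, x = (p : Rint n) • y := by
  rw [pSM, Submodule.ideal_span_singleton_smul, Submodule.mem_smul_pointwise_iff_exists]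
  exact ⟨fun ⟨y, _, h⟩ => ⟨y, h.symm⟩, fun ⟨y, h⟩ => ⟨y, Submodule.mem_top, h.symm⟩⟩

theorem spread_out (n : ℕ) (C : Type*) [CommRing C] (B : Type*) [CommRing B] [Algebra C B]
    (π : Rint n →+* B) (N : ℤ) :
    ∀ r : Rint n, ∃ k : ℕ, (N : B) ^ k * π r ∈
      Algebra.adjoin C (Set.range fun j => (N : B) * π (MvPolynomial.X j)) := by
  set S := Algebra.adjoin C (Set.range fun j => (N : B) * π (MvPolynomial.X j)) with hS
  have hN : ∀ k : ℕ, (N : B) ^ k ∈ S := fun k => pow_mem (intCast_mem S N) k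
  intro r
  induction r using MvPolynomial.induction_on with
  | C a => exact ⟨0, by simp⟩
  | add p q hp hq =>
    obtain ⟨k, hk⟩ := hp
    obtain ⟨l, hl⟩ := hq
    refine ⟨k + l, ?_⟩
    have : (N : B) ^ (k + l) * π (p + q) =
        N ^ l * (N ^ k * π p) + N ^ k * (N ^ l * π q) := by rw [map_add]; ring
    rw [this]
    exact add_mem (mul_mem (hN _) hk) (mul_mem (hN _) hl)
  | mul_X p j hp =>
    obtain ⟨k, hk⟩ := hp
    refine ⟨k + 1, ?_⟩
    have : (N : B) ^ (k + 1) * π (p * MvPolynomial.X j) =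
        (N ^ k * π p) * (N * π (MvPolynomial.X j)) := by rw [map_mul]; ring
    rw [this]
    exact mul_mem hk (Algebra.subset_adjoin ⟨j, rfl⟩)

theorem coprimary_core (n : ℕ) (M : Type*) [AddCommGroup M] [Module (Rint n) M]
    [Module.Finite (Rint n) M] (C : Type*) [CommRing C] [IsDomain C] [IsNoetherianRing C]
    [Algebra C (Rint n)] [Module C M] [IsScalarTower C (Rint n) M]
    (hpr : ∀ p : ℕ, p.Prime → Prime (p : C))
    (P I : Ideal (Rint n)) (hI : ∀ r ∈ I, ∀ m : M, r • m = 0) (hPI : P ≤ I.radical)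
    (hIP : I ≤ P)
    (hreg : ∀ (r : Rint n) (m : M), r ∉ P → r • m = 0 → m = 0)
    (hC : ∀ c : C, algebraMap C (Rint n) c ∈ P → c = 0) (N : ℤ) (hN : N ≠ 0)
    (hint : ∀ j : Fin n, ∃ f : Polynomial C, f.Monic ∧
        f.eval₂ (algebraMap C (Rint n)) ((N : Rint n) * MvPolynomial.X j) ∈ I) :
    {p : ℕ | p.Prime ∧ ¬ ∀ q ∈ associatedPrimes (Rint n) (M ⧸ pSM n p M),
      q ∈ (Ideal.span {(p : Rint n)} ⊔ P).minimalPrimes}.Finite := by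
  classical
  let B := Rint n ⧸ I
  let π : Rint n →+* B := Ideal.Quotient.mk I
  have hπC : π.comp (algebraMap C (Rint n)) = algebraMap C B := rfl
  let S := Algebra.adjoin C (Set.range fun j => (N : B) * π (MvPolynomial.X j))
  have hgenint : ∀ x ∈ Set.range (fun j => (N : B) * π (MvPolynomial.X j)), IsIntegral C x := by
    rintro _ ⟨j, rfl⟩
    obtain ⟨f, hf, hf0⟩ := hint j
    refine ⟨f, hf, ?_⟩
    have := Ideal.Quotient.eq_zero_iff_mem.mpr hf0
    rw [Polynomial.hom_eval₂] at this
    simpa using this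
  have hSfg : S.toSubmodule.FG := fg_adjoin_of_finite (Set.finite_range _) hgenint
  have hSint : ∀ x ∈ S, IsIntegral C x := by
    have : S ≤ integralClosure C B := Algebra.adjoin_le hgenint
    exact fun x hx => this hx
  have hsp := spread_out n C B π N
  obtain ⟨T', hT'⟩ := hSfg
  let T : Finset (Rint n) := T'.image (Function.surjInv Ideal.Quotient.mk_surjective)
  have hT : ∀ b ∈ S, ∃ t ∈ Submodule.span C (T : Set (Rint n)), π t = b := by
    intro b hb
    have hb' : b ∈ Submodule.span C (T' : Set B) := hT' ▸ hb
    induction hb' using Submodule.span_induction with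
    | mem x hx =>
      exact ⟨Function.surjInv Ideal.Quotient.mk_surjective x,
        Submodule.subset_span (Finset.mem_coe.mpr (Finset.mem_image_of_mem _ hx)),
        Function.surjInv_eq _ x⟩
    | zero => exact ⟨0, zero_mem _, map_zero _⟩
    | add x y hx hy h1 h2 =>
      obtain ⟨t, ht, rfl⟩ := h1 (by rw [hT'] at hx; exact hx)
      obtain ⟨u, hu, rfl⟩ := h2 (by rw [hT'] at hy; exact hy)
      exact ⟨t + u, add_mem ht hu, map_add _ _ _⟩
    | smul c x hx h1 =>
      obtain ⟨t, ht, rfl⟩ := h1 (by rw [hT'] at hx; exact hx)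
      exact ⟨c • t, Submodule.smul_mem _ _ ht, rfl⟩
  obtain ⟨G, hG⟩ := (Module.Finite.fg_top : (⊤ : Submodule (Rint n) M).FG)
  let M0 : Submodule C M := Submodule.span C (Set.image2 (fun (r : Rint n) (m : M) => r • m) T G)
  have hM0fin : Module.Finite C M0 :=
    Module.Finite.span_of_finite C (Set.Finite.image2 _ T.finite_toSet G.finite_toSet)
  have hM0 : ∀ (m : M) (r : Rint n), ∃ k : ℕ, (N : Rint n) ^ k • r • m ∈ M0 := by
    intro m
    have hm : m ∈ Submodule.span (Rint n) (G : Set M) := hG ▸ Submodule.mem_top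
    have hNM : ∀ (k : ℕ) (x : M), x ∈ M0 → (N : Rint n) ^ k • x ∈ M0 := by
      intro k x hx
      have : (N : Rint n) ^ k • x = ((N : C) ^ k) • x := by
        rw [← algebraMap_smul (Rint n) ((N : C) ^ k) x]; simp
      rw [this]
      exact M0.smul_mem _ hx
    induction hm using Submodule.span_induction with
    | mem g hg =>
      intro r
      obtain ⟨k, hk⟩ := hsp r
      obtain ⟨t, ht, hte⟩ := hT _ hk
      refine ⟨k, ?_⟩
      have h1 : (N : Rint n) ^ k * r - t ∈ I := by
        rw [← Ideal.Quotient.eq_zero_iff_mem, map_sub, map_mul, map_pow, map_intCast]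
        rw [sub_eq_zero]; exact hte.symm
      have h2 := hI _ h1 g
      rw [sub_smul, sub_eq_zero, mul_smul] at h2
      rw [h2]
      clear h1 h2 hte
      induction ht using Submodule.span_induction with
      | mem x hx => exact Submodule.subset_span ⟨x, hx, g, hg, rfl⟩
      | zero => simp
      | add x y _ _ h1 h2 => rw [add_smul]; exact add_mem h1 h2
      | smul c x _ h1 => rw [smul_assoc]; exact M0.smul_mem _ h1
    | zero => intro r; exact ⟨0, by simp⟩
    | add x y _ _ h1 h2 =>
      intro r
      obtain ⟨k, hk⟩ := h1 r
      obtain ⟨l, hl⟩ := h2 r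
      refine ⟨k + l, ?_⟩
      rw [smul_add, smul_add]
      refine add_mem ?_ ?_
      · rw [add_comm, pow_add, mul_smul]; exact hNM _ _ hk
      · rw [pow_add, mul_smul]; exact hNM _ _ hl
    | smul a x _ h1 =>
      intro r
      obtain ⟨k, hk⟩ := h1 (r * a)
      exact ⟨k, by rwa [smul_smul r a x]⟩
  have hbad := finite_bad_primes_torsionfree C M0 (by
    intro c x hc hx
    ext
    refine hreg (algebraMap C _ c) _ (fun h => hc (hC c h)) ?_
    rw [algebraMap_smul]
    exact congrArg Subtype.val hx) hpr
  have hdiv : {p : ℕ | (p : ℤ) ∣ N}.Finite := by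
    refine (Set.finite_le_nat N.natAbs).subset fun p hp => ?_
    exact Nat.le_of_dvd (Int.natAbs_pos.mpr hN) (Int.natCast_dvd.mp hp)
  refine (hbad.union hdiv).subset ?_
  rintro p ⟨hp, hq⟩
  by_contra hcon
  rw [Set.mem_union, not_or] at hcon
  obtain ⟨hnb, hnd⟩ := hcon
  apply hq
  clear hq
  have hbez : ∀ k : ℕ, ∃ u v : Rint n, u * p + v * (N : Rint n) ^ k = 1 := by
    intro k
    have : IsCoprime (p : ℤ) (N ^ k) :=
      (((Nat.prime_iff_prime_int.mp hp).coprime_iff_not_dvd).mpr hnd).pow_right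
    obtain ⟨u, v, huv⟩ := this
    exact ⟨u, v, by exact_mod_cast congrArg (Int.cast : ℤ → Rint n) huv⟩
  intro q hqa
  obtain ⟨hqp, y, hy⟩ := isAssociatedPrime_iff.mp hqa
  obtain ⟨x, rfl⟩ := Submodule.mkQ_surjective _ y
  have hqmem : ∀ r, r ∈ q ↔ ∃ b : M, r • x = (p : Rint n) • b := by
    intro r
    rw [hy, Submodule.mem_colon_singleton, Submodule.mem_bot, ← map_smul, Submodule.mkQ_apply,
      Submodule.Quotient.mk_eq_zero, mem_pSM]
  have hpq : (p : Rint n) ∈ q := (hqmem _).mpr ⟨x, rfl⟩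
  have hIq : I ≤ q := fun r hr => (hqmem r).mpr ⟨0, by rw [hI r hr, smul_zero]⟩
  have hPq : P ≤ q := hPI.trans (hqp.radical_le_iff.mpr hIq)
  refine ⟨⟨hqp, sup_le ((Ideal.span_singleton_le_iff_mem _).mpr hpq) hPq⟩, ?_⟩
  rintro J ⟨hJp, hJ⟩ hJq z hz
  by_contra hzJ
  have hpJ : (p : Rint n) ∈ J := hJ (Ideal.mem_sup_left (Ideal.mem_span_singleton_self _))
  have hPJ : P ≤ J := le_sup_right.trans hJ
  obtain ⟨k, hk⟩ := hsp z
  obtain ⟨f, hf, hf0⟩ := hSint _ hk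
  have hf0' : f.eval₂ (algebraMap C (Rint n)) ((N : Rint n) ^ k * z) ∈ I := by
    rw [← Ideal.Quotient.eq_zero_iff_mem, Polynomial.hom_eval₂]
    simpa using hf0
  have hNJ : (N : Rint n) ^ k ∉ J := by
    intro h
    obtain ⟨u, v, huv⟩ := hbez k
    apply hJp.ne_top
    rw [Ideal.eq_top_iff_one, ← huv]
    exact add_mem (J.mul_mem_left _ hpJ) (J.mul_mem_left _ h)
  have hz0 : (N : Rint n) ^ k * z ∈ (q : Set (Rint n)) \ J :=
    ⟨q.mul_mem_left _ hz, fun h => (hJp.mem_or_mem h).elim hNJ hzJ⟩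
  have : Nontrivial (C ⧸ J.comap (algebraMap C (Rint n))) :=
    Ideal.Quotient.nontrivial_iff.mpr (hJp.comap _).ne_top
  obtain ⟨i, hi1, hi2⟩ := Ideal.exists_coeff_mem_comap_sdiff_comap_of_root_mem_sdiff hJq hz0
    (hf.map (Ideal.Quotient.mk (J.comap (algebraMap C (Rint n))))).ne_zero
    (hPJ (hIP hf0'))
  set e := f.coeff i
  obtain ⟨b, hb⟩ := (hqmem _).mp hi1
  have hpe : ¬ (p : C) ∣ e := by
    rintro ⟨w, hw⟩
    apply hi2
    rw [hw]
    change algebraMap C (Rint n) _ ∈ J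
    rw [map_mul, map_natCast]
    exact J.mul_mem_right _ hpJ
  obtain ⟨k1, hk1⟩ := hM0 x 1
  obtain ⟨k2, hk2⟩ := hM0 b 1
  rw [one_smul] at hk1 hk2
  have hNM : ∀ (k : ℕ) (x : M), x ∈ M0 → (N : Rint n) ^ k • x ∈ M0 := by
    intro k x hx
    have : (N : Rint n) ^ k • x = ((N : C) ^ k) • x := by
      rw [← algebraMap_smul (Rint n) ((N : C) ^ k) x]; simp
    rw [this]
    exact M0.smul_mem _ hx
  have hx0 : (N : Rint n) ^ (k1 + k2) • x ∈ M0 := by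
    rw [add_comm, pow_add, mul_smul]; exact hNM _ _ hk1
  have hb0 : (N : Rint n) ^ (k1 + k2) • b ∈ M0 := by
    rw [pow_add, mul_smul]; exact hNM _ _ hk2
  have hex : ∃ a' : M0, (⟨_, hx0⟩ : M0) = (p : C) • a' := by
    by_contra hno
    refine hnb ⟨hp, e, ⟨_, hx0⟩, ⟨_, hb0⟩, hpe, ?_, hno⟩
    ext
    simp only [Submodule.coe_smul]
    rw [← algebraMap_smul (Rint n) e, ← algebraMap_smul (Rint n) (p : C), smul_comm, hb,
      smul_comm, map_natCast]
  obtain ⟨a', ha'⟩ := hex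
  have ha'' : (N : Rint n) ^ (k1 + k2) • x = (p : Rint n) • (a' : M) := by
    have := congrArg Subtype.val ha'
    simp only [Submodule.coe_smul] at this
    rw [this, ← algebraMap_smul (Rint n) (p : C), map_natCast]
  obtain ⟨u, v, huv⟩ := hbez (k1 + k2)
  apply hqp.ne_top
  rw [Ideal.eq_top_iff_one, hqmem]
  refine ⟨u • x + v • (a' : M), ?_⟩
  conv_lhs => rw [← huv, add_smul, mul_smul v, ha'']
  module

theorem coprimary_case (n : ℕ) (M : Type*) [AddCommGroup M] [Module (Rint n) M]
    [Module.Finite (Rint n) M] (P : Ideal (Rint n)) (hP : associatedPrimes (Rint n) M = {P}) :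
    {p : ℕ | p.Prime ∧ ¬ ∀ q ∈ associatedPrimes (Rint n) (M ⧸ pSM n p M),
      q ∈ (Ideal.span {(p : Rint n)} ⊔ P).minimalPrimes}.Finite := by
  have hPa : P ∈ associatedPrimes (Rint n) M := hP ▸ Set.mem_singleton P
  have hPp : P.IsPrime := IsAssociatedPrime.isPrime hPa
  set I := Module.annihilator (Rint n) M with hIdef
  have hI : ∀ r ∈ I, ∀ m : M, r • m = 0 := fun r hr m => Module.mem_annihilator.mp hr m
  have hIP : I ≤ P := by
    have := IsAssociatedPrime.annihilator_le hPa
    rwa [Submodule.annihilator_top] at this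
  have hPI : P ≤ I.radical := by
    rw [← Ideal.sInf_minimalPrimes]
    refine le_sInf fun J hJ => ?_
    have := Module.associatedPrimes.minimalPrimes_annihilator_subset_associatedPrimes (Rint n) M hJ
    rw [hP] at this
    exact (Set.mem_singleton_iff.mp this).ge
  have hreg : ∀ (r : Rint n) (m : M), r ∉ P → r • m = 0 → m = 0 := by
    intro r m hr hrm
    by_contra hm
    have : r ∈ ⋃ p ∈ associatedPrimes (Rint n) M, (p : Set (Rint n)) := by
      rw [biUnion_associatedPrimes_eq_zero_divisors]
      exact ⟨m, hm, hrm⟩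
    rw [hP] at this
    exact hr (by simpa using this)
  by_cases hZ : ∀ k : ℤ, k ≠ 0 → (k : Rint n) ∉ P
  · obtain ⟨s, h, N, hN, hinj, hint⟩ := noether_over_int n P I hPI hZ
    let : Algebra (MvPolynomial (Fin s) ℤ) (Rint n) := h.toAlgebra
    let : Module (MvPolynomial (Fin s) ℤ) M := Module.compHom M h
    have : IsScalarTower (MvPolynomial (Fin s) ℤ) (Rint n) M :=
      ⟨fun c r m => mul_smul (h c) r m⟩
    refine coprimary_core n M (MvPolynomial (Fin s) ℤ) ?_ P I hI hPI hIP hreg hinj N hN hint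
    intro p hp
    have := (MvPolynomial.prime_C_iff (σ := Fin s)).mpr (Nat.prime_iff_prime_int.mp hp)
    simpa using this
  · push Not at hZ
    obtain ⟨N, hN, hNP⟩ := hZ
    have hdiv : {p : ℕ | (p : ℤ) ∣ N}.Finite := by
      refine (Set.finite_le_nat N.natAbs).subset fun p hp => ?_
      exact Nat.le_of_dvd (Int.natAbs_pos.mpr hN) (Int.natCast_dvd.mp hp)
    refine hdiv.subset ?_
    rintro p ⟨hp, hq⟩
    by_contra hnd
    apply hq
    intro q hqa
    exfalso
    obtain ⟨hqp, y, hy⟩ := isAssociatedPrime_iff.mp hqa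
    obtain ⟨x, rfl⟩ := Submodule.mkQ_surjective _ y
    have hqmem : ∀ r, r ∈ q ↔ ∃ b : M, r • x = (p : Rint n) • b := by
      intro r
      rw [hy, Submodule.mem_colon_singleton, Submodule.mem_bot, ← map_smul, Submodule.mkQ_apply,
        Submodule.Quotient.mk_eq_zero, mem_pSM]
    have hpq : (p : Rint n) ∈ q := (hqmem _).mpr ⟨x, rfl⟩
    have hIq : I ≤ q := fun r hr => (hqmem r).mpr ⟨0, by rw [hI r hr, smul_zero]⟩
    have hPq : P ≤ q := hPI.trans (hqp.radical_le_iff.mpr hIq)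
    have : IsCoprime (p : ℤ) N :=
      ((Nat.prime_iff_prime_int.mp hp).coprime_iff_not_dvd).mpr hnd
    obtain ⟨u, v, huv⟩ := this
    have h1 : (u : Rint n) * p + v * N = 1 := by
      exact_mod_cast congrArg (Int.cast : ℤ → Rint n) huv
    apply hqp.ne_top
    rw [Ideal.eq_top_iff_one, ← h1]
    exact add_mem (q.mul_mem_left _ hpq) (q.mul_mem_left _ (hPq hNP))

theorem exists_coprimary_quotient (n : ℕ) (M : Type*) [AddCommGroup M] [Module (Rint n) M]
    [Module.Finite (Rint n) M] (P : Ideal (Rint n)) (hP : P ∈ associatedPrimes (Rint n) M) :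
    ∃ N : Submodule (Rint n) M, P ∉ associatedPrimes (Rint n) N ∧
      associatedPrimes (Rint n) (M ⧸ N) = {P} := by
  have hno : IsNoetherian (Rint n) M := inferInstance
  obtain ⟨N, hN, hmax⟩ := set_has_maximal_iff_noetherian.mpr hno
    {N : Submodule (Rint n) M | P ∉ associatedPrimes (Rint n) N}
    ⟨⊥, by simp [associatedPrimes.eq_empty_of_subsingleton]⟩
  refine ⟨N, hN, ?_⟩
  have hsub : associatedPrimes (Rint n) (M ⧸ N) ⊆ {P} := by
    intro P' hP'
    obtain ⟨hP'p, f, hf⟩ := (isAssociatedPrime_iff_exists_injective_linearMap _ _).mp hP'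
    let N' : Submodule (Rint n) M := (LinearMap.range f).comap N.mkQ
    have hle : N ≤ N' := by
      intro x hx
      change N.mkQ x ∈ LinearMap.range f
      rw [Submodule.mkQ_apply, (Submodule.Quotient.mk_eq_zero N).mpr hx]
      exact zero_mem _
    have hlt : N < N' := by
      refine lt_of_le_of_ne hle fun heq => ?_
      have h0 : f 1 = 0 := by
        obtain ⟨x, hx⟩ := Submodule.mkQ_surjective N (f 1)
        have : x ∈ N' := ⟨1, hx.symm⟩
        rw [← heq] at this
        rw [← hx, Submodule.mkQ_apply, (Submodule.Quotient.mk_eq_zero N).mpr this]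
      rw [map_eq_zero_iff _ hf] at h0
      exact hP'p.ne_top ((Ideal.eq_top_iff_one _).mpr (Ideal.Quotient.eq_zero_iff_mem.mp h0))
    have hPN' : P ∈ associatedPrimes (Rint n) N' := by
      by_contra h
      exact hmax N' h hlt
    let g : N' →ₗ[Rint n] LinearMap.range f := N.mkQ.restrict (fun x hx => hx)
    have hex : Function.Exact (Submodule.inclusion hle) g := by
      intro x
      constructor
      · intro hx
        have h1 : N.mkQ (x : M) = 0 := congrArg Subtype.val hx
        rw [Submodule.mkQ_apply, Submodule.Quotient.mk_eq_zero] at h1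
        exact ⟨⟨x, h1⟩, rfl⟩
      · rintro ⟨y, rfl⟩
        ext
        change N.mkQ (y : M) = 0
        rw [Submodule.mkQ_apply, Submodule.Quotient.mk_eq_zero]
        exact y.2
    have := associatedPrimes.subset_union_of_exact (Submodule.inclusion_injective hle) hex hPN'
    rcases this with h | h
    · exact absurd h hN
    · rw [← LinearEquiv.AssociatedPrimes.eq (LinearEquiv.ofInjective f hf),
        associatedPrimes.eq_singleton_of_isPrimary hP'p.isPrimary, hP'p.radical] at h
      exact (Set.mem_singleton_iff.mp h).symm
  refine hsub.antisymm ?_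
  rintro _ rfl
  have hex : Function.Exact N.subtype N.mkQ := by
    rw [LinearMap.exact_iff]; simp
  exact (associatedPrimes.subset_union_of_exact N.injective_subtype hex hP).resolve_left hN

theorem assoc_reduction_subset (n p : ℕ) (M : Type*) [AddCommGroup M] [Module (Rint n) M]
    (N : Submodule (Rint n) M) (htor : ∀ x : M ⧸ N, (p : Rint n) • x = 0 → x = 0) :
    associatedPrimes (Rint n) (M ⧸ pSM n p M) ⊆
      associatedPrimes (Rint n) (N ⧸ pSM n p N) ∪
        associatedPrimes (Rint n) ((M ⧸ N) ⧸ pSM n p (M ⧸ N)) := by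
  let f : (N ⧸ pSM n p N) →ₗ[Rint n] (M ⧸ pSM n p M) :=
    Submodule.mapQ _ _ N.subtype (by
      intro x hx
      obtain ⟨y, rfl⟩ := mem_pSM.mp hx
      exact mem_pSM.mpr ⟨y, rfl⟩)
  let g : (M ⧸ pSM n p M) →ₗ[Rint n] ((M ⧸ N) ⧸ pSM n p (M ⧸ N)) :=
    Submodule.mapQ _ _ N.mkQ (by
      intro x hx
      obtain ⟨y, rfl⟩ := mem_pSM.mp hx
      exact mem_pSM.mpr ⟨N.mkQ y, by rw [map_smul]⟩)
  refine associatedPrimes.subset_union_of_exact (f := f) (g := g) ?_ ?_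
  · rw [injective_iff_map_eq_zero]
    intro x hx
    obtain ⟨x, rfl⟩ := Submodule.mkQ_surjective _ x
    have h1 : (x : M) ∈ pSM n p M := (Submodule.Quotient.mk_eq_zero _).mp hx
    obtain ⟨y, hy⟩ := mem_pSM.mp h1
    have h2 : N.mkQ y = 0 := by
      apply htor
      rw [← map_smul, ← hy, Submodule.mkQ_apply, Submodule.Quotient.mk_eq_zero]
      exact x.2
    rw [Submodule.mkQ_apply, Submodule.Quotient.mk_eq_zero] at h2
    rw [Submodule.mkQ_apply, Submodule.Quotient.mk_eq_zero, mem_pSM]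
    exact ⟨⟨y, h2⟩, Subtype.ext hy⟩
  · intro x
    obtain ⟨x, rfl⟩ := Submodule.mkQ_surjective _ x
    constructor
    · intro hx
      have h1 : N.mkQ x ∈ pSM n p (M ⧸ N) := (Submodule.Quotient.mk_eq_zero _).mp hx
      obtain ⟨y, hy⟩ := mem_pSM.mp h1
      obtain ⟨y, rfl⟩ := Submodule.mkQ_surjective _ y
      have h2 : x - (p : Rint n) • y ∈ N := by
        rw [← Submodule.Quotient.mk_eq_zero, ← Submodule.mkQ_apply, map_sub, hy, map_smul, sub_self]
      refine ⟨(pSM n p N).mkQ ⟨_, h2⟩, ?_⟩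
      change (pSM n p M).mkQ (x - (p : Rint n) • y) = _
      rw [map_sub, sub_eq_self, Submodule.mkQ_apply, Submodule.Quotient.mk_eq_zero, mem_pSM]
      exact ⟨y, rfl⟩
    · rintro ⟨y, hy⟩
      rw [← hy]
      obtain ⟨y, rfl⟩ := Submodule.mkQ_surjective _ y
      change (pSM n p (M ⧸ N)).mkQ (N.mkQ (y : M)) = 0
      have : N.mkQ (y : M) = 0 := by
        rw [Submodule.mkQ_apply, Submodule.Quotient.mk_eq_zero]; exact y.2
      rw [this, map_zero]

theorem stmt_5_aux (n : ℕ) (c : ℕ) : ∀ (M : Type) [AddCommGroup M] [Module (Rint n) M]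
    [Module.Finite (Rint n) M], (associatedPrimes (Rint n) M).ncard = c →
    {p : ℕ | p.Prime ∧
      ¬ (∀ q ∈ associatedPrimes (Rint n) (M ⧸ pSM n p M),
          ∃ 𝔭 ∈ associatedPrimes (Rint n) M,
            q ∈ (Ideal.span {(p : Rint n)} ⊔ 𝔭).minimalPrimes)}.Finite := by
  induction c using Nat.strong_induction_on with
  | _ c ih =>
    intro M _ _ _ hc
    rcases subsingleton_or_nontrivial M with hM | hM
    · refine Set.finite_empty.subset ?_
      rintro p ⟨_, hq⟩
      refine hq fun q hqa => ?_
      rw [associatedPrimes.eq_empty_of_subsingleton] at hqa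
      exact hqa.elim
    · obtain ⟨P, hP⟩ := associatedPrimes.nonempty (Rint n) M
      obtain ⟨N, hPN, hMN⟩ := exists_coprimary_quotient n M P hP
      have hNM : associatedPrimes (Rint n) N ⊆ associatedPrimes (Rint n) M :=
        associatedPrimes.subset_of_injective N.injective_subtype
      have hlt : (associatedPrimes (Rint n) N).ncard < c := by
        rw [← hc]
        exact Set.ncard_lt_ncard ⟨hNM, fun h => hPN (h hP)⟩ (associatedPrimes.finite _ _)
      have h1 := ih _ hlt N rfl
      have h2 := coprimary_case n (M ⧸ N) P hMN
      have h3 := finite_torsion_primes (Rint n) (M ⧸ N)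
      refine ((h1.union h2).union h3).subset ?_
      rintro p ⟨hp, hq⟩
      by_contra hcon
      simp only [Set.mem_union, Set.mem_ofPred_eq, not_or, not_and, not_not] at hcon
      obtain ⟨⟨g1, g2⟩, g3⟩ := hcon
      apply hq
      intro q hqa
      have htor : ∀ x : M ⧸ N, (p : Rint n) • x = 0 → x = 0 := by
        intro x hx
        by_contra hx0
        exact g3 hp ⟨x, hx0, hx⟩
      rcases assoc_reduction_subset n p M N htor hqa with h | h
      · obtain ⟨𝔭, h𝔭, hmin⟩ := g1 hp q h
        exact ⟨𝔭, hNM h𝔭, hmin⟩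
      · exact ⟨P, hP, g2 hp q h⟩

/-- Let `M` be a finitely generated module over `R = ℤ[x₁,…,xₙ]`. For all but
finitely many prime integers `p`, every associated prime of `M̄ = M/pM` is a minimal prime over
an ideal of the form `pR + 𝔭` with `𝔭` an associated prime of `M`. -/
theorem stmt_5 (n : ℕ) (M : Type) [AddCommGroup M] [Module (Rint n) M]
    [Module.Finite (Rint n) M] :
    {p : ℕ | p.Prime ∧
      ¬ (∀ q ∈ associatedPrimes (Rint n) (M ⧸ pSM n p M),
          ∃ 𝔭 ∈ associatedPrimes (Rint n) M,
            q ∈ (Ideal.span {(p : Rint n)} ⊔ 𝔭).minimalPrimes)}.Finite := by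
  exact stmt_5_aux n _ M rfl
end
end

section
/- Let R = ℤ[x₁,…,xₙ], let M be a finitely generated R-module, let t ≥ 0 be an integer, and let 𝔭 be a prime ideal of R of height t. Then Ext^t_{R_𝔭}(M_𝔭, R_𝔭) ≠ 0 if and only if 𝔭 is an associated prime of M. Moreover, for every prime ideal 𝔮 of R of height strictly less than t, Ext^t_{R_𝔮}(M_𝔮, R_𝔮) = 0. -/
open CategoryTheory CategoryTheory.Limits CategoryTheory.Abelian

noncomputable section

/-- `Ext^t_{R_𝔭}(M_𝔭, R_𝔭)` as an object of `ModuleCat`. -/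
noncomputable def ExtLoc (n : ℕ) (M : Type) [AddCommGroup M] [Module (Rint n) M]
    (t : ℕ) (𝔭 : Ideal (Rint n)) [𝔭.IsPrime] : ModuleCat (Localization 𝔭.primeCompl) :=
  ((Ext (Localization 𝔭.primeCompl) (ModuleCat (Localization 𝔭.primeCompl)) t).obj
    (Opposite.op (ModuleCat.of (Localization 𝔭.primeCompl)
      (LocalizedModule 𝔭.primeCompl M)))).obj
    (ModuleCat.of (Localization 𝔭.primeCompl) (Localization 𝔭.primeCompl))

open scoped Pointwise in
open IsLocalRing RingTheory.Sequence in
lemma reg_aux (d : ℕ) : ∀ (A : Type) [CommRing A] [IsLocalRing A] [IsNoetherianRing A]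
    (a : Fin d → A), Ideal.span (Set.range a) = maximalIdeal A →
    (d : WithBot ℕ∞) ≤ ringKrullDim A →
    IsDomain A ∧ ∃ rs : List A, IsWeaklyRegular A rs ∧ Ideal.ofList rs = maximalIdeal A ∧
      rs.length = d := by
  induction d with
  | zero =>
    intro A _ _ _ a ha _
    have hm : maximalIdeal A = ⊥ := by rw [← ha]; simp
    have hf : IsField A := isField_iff_maximalIdeal_eq.mpr hm
    refine ⟨hf.isDomain, [], IsWeaklyRegular.nil A A, ?_, rfl⟩
    rw [hm]; simp
  | succ d ih =>
    intro A _ _ _ a ha hd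
    have hht : ((d : ℕ∞) + 1) ≤ (maximalIdeal A).height := by
      rw [← maximalIdeal_height_eq_ringKrullDim] at hd
      exact_mod_cast hd
    have hne : maximalIdeal A ≠ ⊥ := by
      intro h
      rw [h] at hht
      have : (⊥ : Ideal A).height ≤ 0 := by
        simp
      have := hht.trans this
      simp at this
    obtain ⟨x, hxm, hxn⟩ : ∃ x ∈ maximalIdeal A, x ∉ ⋃ I ∈ insert ((maximalIdeal A)^2) (minimalPrimes A), (I : Set A) := by
      by_contra! hcon
      obtain ⟨I, hI, hle⟩ := (Ideal.subset_union_prime_finite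
        ((minimalPrimes.finite_of_isNoetherianRing A).insert ((maximalIdeal A)^2)) (f := id)
        ((maximalIdeal A)^2) ((maximalIdeal A)^2) (by
          intro i hi h1 _
          rcases hi with rfl | hi
          · exact absurd rfl h1
          · exact hi.1.1)).1 hcon
      rcases hI with rfl | hI
      · apply hne
        apply Submodule.eq_bot_of_le_smul_of_le_jacobson_bot (maximalIdeal A) _
          (IsNoetherian.noetherian _) _ (by rw [jacobson_eq_maximalIdeal ⊥ bot_ne_top])
        simpa [pow_two] using hle
      · have hI' : I.IsPrime := hI.1.1
        have : I = maximalIdeal A := le_antisymm (le_maximalIdeal hI'.ne_top) hle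
        subst this
        have h0 : (maximalIdeal A).height = 0 := Ideal.height_eq_zero_iff.2 hI
        rw [h0] at hht
        simp at hht
    simp only [Set.mem_insert_iff, Set.iUnion_iUnion_eq_or_left, Set.mem_union, SetLike.mem_coe, Set.mem_iUnion, not_or, not_exists] at hxn
    obtain ⟨hx2, hxp⟩ := hxn
    obtain ⟨c, hc⟩ := (Ideal.mem_span_range_iff_exists_fun).1 (ha ▸ hxm)
    have ham : ∀ i, a i ∈ maximalIdeal A := fun i => ha ▸ Ideal.subset_span ⟨i, rfl⟩
    obtain ⟨i, hi⟩ : ∃ i, IsUnit (c i) := by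
      by_contra! hcon
      apply hx2
      rw [← hc, pow_two]
      exact Ideal.sum_mem _ fun i _ => Ideal.mul_mem_mul ((mem_maximalIdeal _).2 (hcon i)) (ham i)
    let I := Ideal.span {x}
    have hIm : I ≤ maximalIdeal A := (Ideal.span_singleton_le_iff_mem _).2 hxm
    have : Nontrivial (A ⧸ I) := Ideal.Quotient.nontrivial_iff.2 (fun h => (maximalIdeal.isMaximal A).ne_top (top_le_iff.1 (h ▸ hIm)))
    have : IsLocalRing (A ⧸ I) := IsLocalRing.of_surjective' (Ideal.Quotient.mk I) Ideal.Quotient.mk_surjective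
    have hmap : (maximalIdeal A).map (Ideal.Quotient.mk I) = maximalIdeal (A ⧸ I) := by
      have hloc : IsLocalHom (Ideal.Quotient.mk I) := IsLocalHom.of_surjective _ Ideal.Quotient.mk_surjective
      rw [← maximalIdeal_comap (Ideal.Quotient.mk I),
        Ideal.map_comap_of_surjective _ Ideal.Quotient.mk_surjective]
    have hspan : Ideal.span (Set.range (fun j => Ideal.Quotient.mk I (a (i.succAbove j)))) = maximalIdeal (A ⧸ I) := by
      rw [← hmap, ← ha, Ideal.map_span]
      apply le_antisymm
      · apply Ideal.span_mono
        rintro _ ⟨j, rfl⟩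
        exact ⟨_, ⟨_, rfl⟩, rfl⟩
      · rw [Ideal.span_le]
        rintro _ ⟨_, ⟨j, rfl⟩, rfl⟩
        have hj : ∀ j, Ideal.Quotient.mk I (a (i.succAbove j)) ∈ Ideal.span (Set.range (fun j => Ideal.Quotient.mk I (a (i.succAbove j)))) := fun j => Ideal.subset_span ⟨j, rfl⟩
        rcases Fin.eq_self_or_eq_succAbove i j with rfl | ⟨j, rfl⟩
        · have h0 : Ideal.Quotient.mk I x = 0 := Ideal.Quotient.eq_zero_iff_mem.2 (Ideal.mem_span_singleton_self x)
          rw [← hc, map_sum, Fin.sum_univ_succAbove _ j] at h0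
          have := (hi.map (Ideal.Quotient.mk I))
          rw [SetLike.mem_coe, ← Ideal.unit_mul_mem_iff_mem _ this, ← map_mul, eq_neg_of_add_eq_zero_left h0]
          apply neg_mem
          refine Ideal.sum_mem _ fun l _ => ?_
          rw [map_mul]
          exact Ideal.mul_mem_left _ _ (hj l)
        · exact hj j
    have hdim : (d : WithBot ℕ∞) ≤ ringKrullDim (A ⧸ I) := by
      have := Ideal.height_le_ringKrullDim_quotient_add_one hxm
      have h2 : ((d : WithBot ℕ∞) + 1) ≤ ringKrullDim (A ⧸ I) + 1 := le_trans (by exact_mod_cast hht) this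
      exact ENat.WithBot.add_le_add_one_right_iff.1 h2
    obtain ⟨hdom, rs, hreg, hrs, hlen⟩ := ih (A ⧸ I) _ hspan hdim
    have hIp : I.IsPrime := (Ideal.Quotient.isDomain_iff_prime I).1 hdom
    obtain ⟨q, hq, hqI⟩ := Ideal.exists_minimalPrimes_le (bot_le : ⊥ ≤ I)
    have hqp : q.IsPrime := hq.1.1
    have hq0 : q = ⊥ := by
      apply Submodule.eq_bot_of_le_smul_of_le_jacobson_bot (maximalIdeal A) _
          (IsNoetherian.noetherian _) _ (by rw [jacobson_eq_maximalIdeal ⊥ bot_ne_top])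
      intro y hy
      obtain ⟨z, rfl⟩ := Ideal.mem_span_singleton'.1 (hqI hy)
      have hz := (hqp.mem_or_mem hy).resolve_right (hxp q hq)
      rw [mul_comm]
      exact Ideal.mul_mem_mul hxm hz
    subst hq0
    have hAd : IsDomain A := IsDomain.of_bot_isPrime A
    have hx0 : x ≠ 0 := fun h => hxp _ hq (by simp [h])
    refine ⟨hAd, x :: rs.map (Function.surjInv Ideal.Quotient.mk_surjective), ?_, ?_, by simpa using hlen⟩
    · refine IsWeaklyRegular.cons' (fun u v huv => mul_left_cancel₀ hx0 huv) ?_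
      have hmm : (rs.map (Function.surjInv Ideal.Quotient.mk_surjective)).map
          (Ideal.Quotient.mk I) = rs := by
        rw [List.map_map]
        convert List.map_id rs
        funext u
        exact Function.surjInv_eq _ u
      change IsWeaklyRegular (QuotSMulTop x A) ((rs.map (Function.surjInv Ideal.Quotient.mk_surjective)).map
          (Ideal.Quotient.mk I))
      rw [hmm]
      have hIx : I = x • (⊤ : Ideal A) := by simp [I, ← Submodule.ideal_span_singleton_smul]
      let e : (A ⧸ I) ≃+ QuotSMulTop x A := (Submodule.quotEquivOfEq _ _ hIx).toAddEquiv
      refine (e.isWeaklyRegular_congr (as := rs) (bs := rs) ?_).1 hreg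
      refine List.forall₂_same.mpr fun r _ u => ?_
      obtain ⟨r, rfl⟩ := Ideal.Quotient.mk_surjective r
      exact (Submodule.quotEquivOfEq _ _ hIx).map_smul r u
    · rw [Ideal.ofList_cons]
      have hmm : (rs.map (Function.surjInv Ideal.Quotient.mk_surjective)).map
          (Ideal.Quotient.mk I) = rs := by
        rw [List.map_map]
        convert List.map_id rs
        funext u
        exact Function.surjInv_eq _ u
      have h1 := congrArg (Ideal.comap (Ideal.Quotient.mk I)) hrs
      rw [← hmm, ← Ideal.map_ofList, ← hmap, Ideal.comap_map_of_surjective _ Ideal.Quotient.mk_surjective, Ideal.comap_map_of_surjective _ Ideal.Quotient.mk_surjective, ← RingHom.ker_eq_comap_bot, Ideal.mk_ker, sup_eq_left.2 hIm, sup_comm] at h1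
      exact h1


lemma ext_bridge {A : Type} [CommRing A] (X Y : ModuleCat.{0} A) (n : ℕ) :
    IsZero (((_root_.Ext A (ModuleCat.{0} A) n).obj (Opposite.op X)).obj Y) ↔
      Subsingleton (CategoryTheory.Abelian.Ext X Y n) := by
  let P := ProjectiveResolution.of X
  have h1 : IsZero (((_root_.Ext A (ModuleCat.{0} A) n).obj (Opposite.op X)).obj Y) ↔
      (P.complex.linearYonedaObj A Y).ExactAt n := by
    rw [HomologicalComplex.exactAt_iff_isZero_homology]
    exact (P.isoExt n Y).isZero_iff
  rw [h1]
  cases n with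
  | zero =>
    rw [HomologicalComplex.exactAt_iff' _ 0 0 1 (by simp) (by simp)]
    rw [ShortComplex.moduleCat_exact_iff, Ext.homEquiv₀.subsingleton_congr]
    constructor
    · intro h
      refine subsingleton_of_forall_eq 0 fun f => ?_
      let f' : ((ChainComplex.single₀ (ModuleCat.{0} A)).obj X).X 0 ⟶ Y := f
      have hz : P.complex.d 1 0 ≫ P.π.f 0 ≫ f' = 0 := by
        rw [P.complex_d_comp_π_f_zero_assoc, zero_comp]
      obtain ⟨u, hu⟩ := h (P.π.f 0 ≫ f') hz
      have hd : (P.complex.linearYonedaObj A Y).d 0 0 = 0 :=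
        HomologicalComplex.shape _ _ _ (by simp)
      have hu' : (P.complex.linearYonedaObj A Y).d 0 0 u = P.π.f 0 ≫ f' := hu
      rw [hd] at hu'
      have h0 : P.π.f 0 ≫ f' = 0 := hu'.symm
      have := Cofork.IsColimit.hom_ext P.isColimitCokernelCofork (k := f') (l := 0)
        (by exact h0.trans comp_zero.symm)
      exact this
    · intro h f hf
      refine ⟨0, ?_⟩
      rw [map_zero]
      have hf' : P.complex.d 1 0 ≫ f = 0 := hf
      obtain ⟨l, hl⟩ := CokernelCofork.IsColimit.desc' P.isColimitCokernelCofork f hf'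
      let l' : X ⟶ Y := l
      have hl0 : l' = 0 := Subsingleton.elim _ _
      have hl1 : l = 0 := hl0
      rw [hl1, comp_zero] at hl
      exact hl
  | succ n =>
    rw [HomologicalComplex.exactAt_iff' _ n (n+1) (n+2) (by simp) (by simp)]
    rw [ShortComplex.moduleCat_exact_iff]
    constructor
    · intro h
      refine subsingleton_of_forall_eq 0 fun α => ?_
      obtain ⟨f, hf, rfl⟩ := P.extMk_surjective α (n+2) rfl
      rw [P.extMk_eq_zero_iff f _ rfl hf n rfl]
      exact h f hf
    · intro h f hf
      exact (P.extMk_eq_zero_iff f (n+2) rfl hf n rfl).1 (Subsingleton.elim _ _)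


lemma ext_smul_aux {A : Type} [CommRing A] (M Y : ModuleCat.{0} A) (x : A) (i : ℕ)
    (z : Abelian.Ext M Y i) : (Ext.mk₀ (x • 𝟙 M)).comp z (zero_add i) = x • z := by
  rw [Ext.mk₀_smul, Ext.smul_comp, Ext.mk₀_id_comp]

open IsLocalRing in
lemma ext_nak {A : Type} [CommRing A] [IsLocalRing A] [IsNoetherianRing A]
    (M Y : ModuleCat.{0} A) [Module.Finite A M] [Module.Finite A Y] (x : A)
    (reg : IsSMulRegular M x) (mem : x ∈ maximalIdeal A) (i : ℕ)
    (zero : Subsingleton (Abelian.Ext (ModuleCat.of A (QuotSMulTop x M)) Y (i + 1))) :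
    Subsingleton (Abelian.Ext M Y i) := by
  have hS : (M.smulShortComplex x).ShortExact := reg.smulShortComplex_shortExact
  have key : ∀ y : Abelian.Ext M Y i, ∃ z : Abelian.Ext M Y i, x • z = y := by
    intro y
    obtain ⟨z, hz⟩ := Ext.contravariant_sequence_exact₁ hS Y y (add_comm 1 i)
      (zero.elim _ _)
    exact ⟨z, (ext_smul_aux M Y x i z).symm.trans hz⟩
  by_contra ntr
  rw [not_subsingleton_iff_nontrivial] at ntr
  have : x ∈ (Module.annihilator A (Abelian.Ext M Y i)).jacobson :=
    (IsLocalRing.maximalIdeal_le_jacobson _) mem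
  apply Submodule.top_ne_pointwise_smul_of_mem_jacobson_annihilator this
  rw [eq_comm, eq_top_iff]
  intro y _
  obtain ⟨z, rfl⟩ := key y
  exact Submodule.smul_mem_pointwise_smul _ _ ⊤ trivial

lemma ext_mid {A : Type} [CommRing A] {S : ShortComplex (ModuleCat.{0} A)} (hS : S.ShortExact)
    (Y : ModuleCat.{0} A) (i : ℕ) (h1 : Subsingleton (Abelian.Ext S.X₁ Y i))
    (h3 : Subsingleton (Abelian.Ext S.X₃ Y i)) : Subsingleton (Abelian.Ext S.X₂ Y i) := by
  refine subsingleton_of_forall_eq 0 fun y => ?_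
  obtain ⟨z, hz⟩ := Ext.contravariant_sequence_exact₂ hS Y y (Subsingleton.elim _ _)
  rw [← hz, Subsingleton.elim z 0, Ext.comp_zero]

lemma ext_equiv {A : Type} [CommRing A] {X X' : ModuleCat.{0} A} (e : X ≃ₗ[A] X')
    (Y : ModuleCat.{0} A) (i : ℕ) (h1 : Subsingleton (Abelian.Ext X Y i)) :
     Subsingleton (Abelian.Ext X' Y i) := by
  refine subsingleton_of_forall_eq 0 fun y => ?_
  have : (Ext.mk₀ e.toModuleIso.inv).comp ((Ext.mk₀ e.toModuleIso.hom).comp y (zero_add i)) (zero_add i) = y := by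
    rw [Ext.mk₀_comp_mk₀_assoc, Iso.inv_hom_id, Ext.mk₀_id_comp]
  rw [← this, Subsingleton.elim ((Ext.mk₀ e.toModuleIso.hom).comp y (zero_add i)) 0, Ext.comp_zero]

open IsLocalRing in
lemma ext_bass {A : Type} [CommRing A] [IsLocalRing A] [IsNoetherianRing A]
    (Y : ModuleCat.{0} A) [Module.Finite A Y] (t : ℕ)
    (hk : ∀ i, t < i → Subsingleton (Abelian.Ext (ModuleCat.of A (A ⧸ maximalIdeal A)) Y i))
    (I : Ideal A) :
    ∀ (M : Type) [AddCommGroup M] [Module A M] [Module.Finite A M],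
      I ≤ Module.annihilator A M → ∀ i, t < i →
      Subsingleton (Abelian.Ext (ModuleCat.of A M) Y i) := by
  induction I using WellFoundedGT.induction with
  | ind I ih =>
  intro M _ _ hM
  refine IsNoetherianRing.induction_on_isQuotientEquivQuotientPrime A hM
    (motive := fun N _ _ _ => I ≤ Module.annihilator A N → ∀ i, t < i →
      Subsingleton (Abelian.Ext (ModuleCat.of A N) Y i)) ?_ ?_ ?_
  · intro N _ _ _ _ _ i _
    have hz : IsZero (ModuleCat.of A N) := ModuleCat.isZero_of_subsingleton _
    refine subsingleton_of_forall_eq 0 fun y => ?_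
    rw [← Ext.mk₀_id_comp y, hz.eq_of_src (𝟙 _) 0, Ext.mk₀_zero, Ext.zero_comp]
  · intro N _ _ _ p e hI i hi
    by_cases hp : p.1 = maximalIdeal A
    · rw [hp] at e
      exact ext_equiv (X := ModuleCat.of A (A ⧸ maximalIdeal A)) (X' := ModuleCat.of A N) e.symm Y i (hk i hi)
    · obtain ⟨x, hxm, hxp⟩ : ∃ x ∈ maximalIdeal A, x ∉ p.1 := by
        by_contra! hcon
        exact hp (le_antisymm (le_maximalIdeal p.2.ne_top) hcon)
      have hIp : I ≤ p.1 := by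
        rw [e.annihilator_eq, Ideal.annihilator_quotient] at hI
        exact hI
      refine ext_nak (ModuleCat.of A N) Y x ?_ hxm i ?_
      · intro u v huv
        apply e.injective
        have h2 : x • (e u - e v) = 0 := by
          have h3 : x • u = x • v := huv
          rw [smul_sub, ← map_smul, ← map_smul, h3, sub_self]
        rw [← sub_eq_zero]
        generalize e u - e v = w at h2 ⊢
        obtain ⟨w, rfl⟩ := Ideal.Quotient.mk_surjective w
        have h4 : Ideal.Quotient.mk p.1 (x * w) = 0 := h2
        rw [Ideal.Quotient.eq_zero_iff_mem] at h4 ⊢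
        exact (p.2.mem_or_mem h4).resolve_left hxp
      · refine ih (I ⊔ Ideal.span {x}) ?_ _ ?_ (i + 1) (by omega)
        · refine lt_of_le_of_ne le_sup_left fun h => hxp (hIp ?_)
          rw [h]
          exact Ideal.mem_sup_right (Ideal.mem_span_singleton_self x)
        · refine sup_le (hI.trans ?_) ?_
          · exact LinearMap.annihilator_le_of_surjective (Submodule.mkQ _) (Submodule.mkQ_surjective _)
          · rw [Ideal.span_singleton_le_iff_mem]
            exact QuotSMulTop.mem_annihilator N x
  · intro N₁ _ _ _ N₂ _ _ _ N₃ _ _ _ f g hf hg hfg h1 h3 hI i hi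
    let S : ShortComplex (ModuleCat.{0} A) := ShortComplex.mk (ModuleCat.ofHom f) (ModuleCat.ofHom g)
      (by ext u; exact hfg.apply_apply_eq_zero u)
    have hS : S.ShortExact := 
      { exact := (ShortComplex.ShortExact.moduleCat_exact_iff_function_exact S).2 hfg
        mono_f := (ModuleCat.mono_iff_injective _).2 hf
        epi_g := (ModuleCat.epi_iff_surjective _).2 hg }
    exact ext_mid hS Y i
      (h1 (hI.trans (LinearMap.annihilator_le_of_injective f hf)) i hi)
      (h3 (hI.trans (LinearMap.annihilator_le_of_surjective g hg)) i hi)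


open IsLocalRing RingTheory.Sequence in
lemma pd_res (A : Type) [CommRing A] [IsRegularLocalRing A] (d : ℕ)
    (hd : ringKrullDim A = (d : WithBot ℕ∞)) :
    projectiveDimension (ModuleCat.of A (A ⧸ maximalIdeal A)) = (d : WithBot ℕ∞) := by
  have hfg : (maximalIdeal A).FG := (isNoetherianRing_iff_ideal_fg A).mp inferInstance _
  have hs : (maximalIdeal A).spanFinrank = d := by
    have := IsRegularLocalRing.spanFinrank_maximalIdeal (R := A)
    rw [hd] at this
    exact_mod_cast this
  have hfin : (maximalIdeal A).generators.Finite := Submodule.FG.finite_generators hfg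
  have hcard : (maximalIdeal A).generators.ncard = d := by
    rw [Submodule.FG.generators_ncard hfg, hs]
  have := hfin.to_subtype
  let e : (maximalIdeal A).generators ≃ Fin d := Finite.equivFinOfCardEq hcard
  have hspan : Ideal.span (Set.range (fun i => ((e.symm i : (maximalIdeal A).generators) : A))) =
      maximalIdeal A := by
    have hr : Set.range (fun i => ((e.symm i : (maximalIdeal A).generators) : A)) =
        (maximalIdeal A).generators := by
      ext u
      constructor
      · rintro ⟨i, rfl⟩
        exact (e.symm i).2
      · intro hu
        exact ⟨e ⟨u, hu⟩, by simp⟩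
    rw [hr]
    exact Submodule.span_generators _
  obtain ⟨-, rs, hrs, hof, hlen⟩ := reg_aux d A _ hspan hd.ge
  have hreg : IsRegular A rs := by
    refine ⟨hrs, ?_⟩
    rw [hof, smul_eq_mul, Ideal.mul_top]
    exact (maximalIdeal.isMaximal A).ne_top.symm
  have h := ModuleCat.projectiveDimension_quotient_eq_length.{0} rs hreg
  rw [hlen] at h
  rw [← h]
  refine ModuleCat.projectiveDimension_eq_of_linearEquiv ?_
  exact (Submodule.quotEquivOfEq _ _ hof.symm).trans (Shrink.linearEquiv A _).symm

lemma ext_free {A : Type} [CommRing A] (X : ModuleCat.{0} A) (d n : ℕ)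
    (h : Subsingleton (Abelian.Ext X (ModuleCat.of A A) d)) :
    Subsingleton (Abelian.Ext X (ModuleCat.of A (Fin n → A)) d) := by
  refine subsingleton_of_forall_eq 0 fun y => ?_
  let f : Fin n → (ModuleCat.of A (Fin n → A) ⟶ ModuleCat.of A (Fin n → A)) := fun i =>
    ModuleCat.ofHom (LinearMap.proj (R := A) (φ := fun _ : Fin n => A) i) ≫
      ModuleCat.ofHom (LinearMap.single A (fun _ : Fin n => A) i)
  have hid : 𝟙 (ModuleCat.of A (Fin n → A)) = ∑ i, f i := by
    ext1
    rw [ModuleCat.hom_sum, ModuleCat.hom_id]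
    refine LinearMap.ext fun v => ?_
    rw [LinearMap.sum_apply]
    funext j
    rw [Finset.sum_apply]
    simp [f, Pi.single_apply]
  have hz : ∀ s : Finset (Fin n), y.comp (Ext.mk₀ (∑ i ∈ s, f i)) (add_zero d) = 0 := by
    intro s
    classical
    induction s using Finset.induction_on with
    | empty => rw [Finset.sum_empty, Ext.mk₀_zero, Ext.comp_zero]
    | insert a s ha ih =>
      rw [Finset.sum_insert ha, Ext.mk₀_add, Ext.comp_add, ih, add_zero]
      simp only [f]
      rw [← Ext.mk₀_comp_mk₀, ← Ext.comp_assoc_of_second_deg_zero,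
        Subsingleton.elim (y.comp _ _) 0, Ext.zero_comp]
  rw [← Ext.comp_mk₀_id y, hid]
  exact hz _

open IsLocalRing in
lemma ext_res_ne (A : Type) [CommRing A] [IsRegularLocalRing A] (d : ℕ)
    (hd : ringKrullDim A = (d : WithBot ℕ∞)) :
    ¬ Subsingleton (Abelian.Ext (ModuleCat.of A (A ⧸ maximalIdeal A)) (ModuleCat.of A A) d) := by
  intro h
  have hpd := pd_res A d hd
  have hle : HasProjectiveDimensionLT (ModuleCat.of A (A ⧸ maximalIdeal A)) (d + 1) :=
    (projectiveDimension_le_iff _ _).1 hpd.le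
  have hlt : HasProjectiveDimensionLT (ModuleCat.of A (A ⧸ maximalIdeal A)) d := by
    apply ModuleCat.hasProjectiveDimensionLT_of_forall_finite
    intro L hL
    obtain ⟨n, g, hg⟩ := Module.Finite.exists_fin' A L
    let S : ShortComplex (ModuleCat.{0} A) :=
      ShortComplex.mk (ModuleCat.ofHom (LinearMap.ker g).subtype) (ModuleCat.ofHom g)
      (by ext u; exact u.2)
    have hS : S.ShortExact :=
      { exact := (ShortComplex.ShortExact.moduleCat_exact_iff_function_exact S).2
          (LinearMap.exact_subtype_ker_map g)
        mono_f := (ModuleCat.mono_iff_injective _).2 (Submodule.subtype_injective _)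
        epi_g := (ModuleCat.epi_iff_surjective _).2 hg }
    have h1 : Subsingleton (Abelian.Ext (ModuleCat.of A (A ⧸ maximalIdeal A)) S.X₁ (d + 1)) :=
      HasProjectiveDimensionLT.subsingleton _ (d + 1) _ le_rfl _
    have h2 : Subsingleton (Abelian.Ext (ModuleCat.of A (A ⧸ maximalIdeal A)) S.X₂ d) :=
      ext_free _ d n h
    refine subsingleton_of_forall_eq 0 fun y => ?_
    obtain ⟨z, hz⟩ := Ext.covariant_sequence_exact₃ _ hS y rfl (Subsingleton.elim _ _)
    rw [← hz, Subsingleton.elim z 0, Ext.zero_comp]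
  exact (projectiveDimension_ge_iff _ _).1 hpd.ge hlt

open IsLocalRing in
lemma ext_high (A : Type) [CommRing A] [IsRegularLocalRing A] (d : ℕ)
    (hd : ringKrullDim A = (d : WithBot ℕ∞)) (M : Type) [AddCommGroup M] [Module A M]
    [Module.Finite A M] (i : ℕ) (hi : d < i) :
    Subsingleton (Abelian.Ext (ModuleCat.of A M) (ModuleCat.of A A) i) := by
  have hle : HasProjectiveDimensionLT (ModuleCat.of A (A ⧸ maximalIdeal A)) (d + 1) :=
    (projectiveDimension_le_iff _ _).1 (pd_res A d hd).le
  have : Module.Finite A (ModuleCat.of A A) := inferInstanceAs (Module.Finite A A)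
  refine ext_bass (ModuleCat.of A A) d (fun j hj => ?_) ⊥ M bot_le i hi
  exact HasProjectiveDimensionLT.subsingleton _ (d + 1) _ hj _

open IsLocalRing in
lemma ext_ass (A : Type) [CommRing A] [IsRegularLocalRing A] (d : ℕ)
    (hd : ringKrullDim A = (d : WithBot ℕ∞)) (M : Type) [AddCommGroup M] [Module A M]
    [Module.Finite A M] :
    ¬ Subsingleton (Abelian.Ext (ModuleCat.of A M) (ModuleCat.of A A) d) ↔
      maximalIdeal A ∈ associatedPrimes A M := by
  constructor
  · intro h
    by_contra hm
    apply h
    have hx : ¬ ((maximalIdeal A : Set A) ⊆ ⋃ I ∈ associatedPrimes A M, I) := by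
      rw [Ideal.subset_iUnion_iff_mem_of_isMaximal_of_finite (associatedPrimes.finite A M)
        ⊥ ⊥ (fun I hI _ _ => hI.1) bot_ne_top bot_ne_top]
      exact hm
    rw [biUnion_associatedPrimes_eq_compl_regular, Set.not_subset] at hx
    obtain ⟨x, hxm, hx⟩ := hx
    have hreg : IsSMulRegular M x := by
      by_contra hc
      exact hx hc
    have : Module.Finite A (ModuleCat.of A A) := inferInstanceAs (Module.Finite A A)
    have : Module.Finite A (ModuleCat.of A M) := inferInstanceAs (Module.Finite A M)
    exact ext_nak (ModuleCat.of A M) (ModuleCat.of A A) x hreg hxm d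
      (ext_high A d hd (QuotSMulTop x M) (d + 1) (Nat.lt_succ_self d))
  · intro hm h
    obtain ⟨-, f, hf⟩ := (isAssociatedPrime_iff_exists_injective_linearMap _ _).1
      (show IsAssociatedPrime (maximalIdeal A) M from hm)
    let S : ShortComplex (ModuleCat.{0} A) :=
      ShortComplex.mk (ModuleCat.ofHom f) (ModuleCat.ofHom (LinearMap.range f).mkQ)
      (by ext u; exact (Submodule.Quotient.mk_eq_zero _).2 ⟨_, rfl⟩)
    have hS : S.ShortExact :=
      { exact := (ShortComplex.ShortExact.moduleCat_exact_iff_function_exact S).2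
          (LinearMap.exact_map_mkQ_range f)
        mono_f := (ModuleCat.mono_iff_injective _).2 hf
        epi_g := (ModuleCat.epi_iff_surjective _).2 (Submodule.mkQ_surjective _) }
    have h3 : Subsingleton (Abelian.Ext S.X₃ (ModuleCat.of A A) (d + 1)) :=
      ext_high A d hd (M ⧸ LinearMap.range f) (d + 1) (Nat.lt_succ_self d)
    have h2 : Subsingleton (Abelian.Ext S.X₂ (ModuleCat.of A A) d) := h
    refine ext_res_ne A d hd (subsingleton_of_forall_eq 0 fun y => ?_)
    obtain ⟨z, hz⟩ := Ext.contravariant_sequence_exact₁ hS _ y (add_comm 1 d)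
      (Subsingleton.elim _ _)
    rw [← hz, Subsingleton.elim z 0, Ext.comp_zero]

/-- **Statement 15.** Let `M` be a finitely generated module over `R = ℤ[x₁,…,xₙ]`, `t ≥ 0`,
and `𝔭` a prime of height `t` (height = Krull dimension of `R_𝔭`). Then
`Ext^t_{R_𝔭}(M_𝔭, R_𝔭) ≠ 0` iff `𝔭` is an associated prime of `M`; moreover
`Ext^t_{R_𝔮}(M_𝔮, R_𝔮) = 0` for every prime `𝔮` of height `< t`. -/
theorem stmt_15 (n : ℕ) (M : Type) [AddCommGroup M] [Module (Rint n) M]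
    [Module.Finite (Rint n) M] (t : ℕ) (𝔭 : Ideal (Rint n)) [𝔭.IsPrime]
    (ht : ringKrullDim (Localization 𝔭.primeCompl) = (t : WithBot (WithTop ℕ))) :
    (¬ IsZero (ExtLoc n M t 𝔭) ↔ 𝔭 ∈ associatedPrimes (Rint n) M) ∧
    (∀ (𝔮 : Ideal (Rint n)) [𝔮.IsPrime],
      ringKrullDim (Localization 𝔮.primeCompl) < (t : WithBot (WithTop ℕ)) →
      IsZero (ExtLoc n M t 𝔮)) := by
  have hmain := fun (𝔮 : Ideal (Rint n)) (h𝔮 : 𝔮.IsPrime) =>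
    (inferInstance : IsRegularLocalRing (Localization.AtPrime 𝔮))
  constructor
  · have : IsRegularLocalRing (Localization 𝔭.primeCompl) := hmain 𝔭 inferInstance
    have key := ext_ass (Localization 𝔭.primeCompl) t ht (LocalizedModule 𝔭.primeCompl M)
    unfold ExtLoc
    rw [ext_bridge, key]
    rw [← Module.associatedPrimes.preimage_comap_associatedPrimes_eq_associatedPrimes_of_isLocalizedModule
      𝔭.primeCompl (Localization 𝔭.primeCompl) (LocalizedModule.mkLinearMap 𝔭.primeCompl M),
      Set.mem_preimage]
    have hc : Ideal.comap (algebraMap (Rint n) (Localization 𝔭.primeCompl))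
        (IsLocalRing.maximalIdeal (Localization 𝔭.primeCompl)) = 𝔭 :=
      Localization.AtPrime.under_maximalIdeal
    rw [hc]
  · intro 𝔮 _ hlt
    have : IsRegularLocalRing (Localization 𝔮.primeCompl) := hmain 𝔮 inferInstance
    have hs := IsRegularLocalRing.spanFinrank_maximalIdeal (R := Localization 𝔮.primeCompl)
    unfold ExtLoc
    rw [ext_bridge]
    refine ext_high (Localization 𝔮.primeCompl) _ hs.symm (LocalizedModule 𝔮.primeCompl M) t ?_
    rw [← hs] at hlt
    have hlt' : ((Submodule.spanFinrank (IsLocalRing.maximalIdeal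
        (Localization 𝔮.primeCompl)) : ℕ) : WithBot ℕ∞) < (t : WithBot ℕ∞) := hlt
    exact_mod_cast hlt'
end
end
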